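/- Fix a ∈ (0,1), τ > 0 and p ≥ 1. For an integer N ≥ 1 set ε_N := (∑_{k∈ℤ²∖{0}, |k|≤N} |k|^{−2a})^{−1/2}, and define θ^{(N)} : ℤ²∖{0} → ℝ by θ^{(N)}_k = ε_N |k|^{−a} if 1 ≤ |k| ≤ N and θ^{(N)}_k = 0 otherwise. Then lim_{N→∞} N^{−pτ} ∑_{k∈ℤ²∖{0}} (θ^{(N)}_k)² |k|^{pτ} = (2−2a)/(2−2a+pτ). -/

import Mathlib

namespace Stmt4

open Filter Topology MeasureTheory Set

/-- The Euclidean norm on nonzero lattice points. -/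
noncomputable def nu (k : {k : ℤ × ℤ // k ≠ 0}) : ℝ :=
  Real.sqrt ((k.1.1 : ℝ) ^ 2 + (k.1.2 : ℝ) ^ 2)

lemma one_le_nu (k : {k : ℤ × ℤ // k ≠ 0}) : 1 ≤ nu k := by
  obtain ⟨⟨x, y⟩, hk⟩ := k
  unfold nu
  rw [Real.one_le_sqrt]
  have : (1 : ℤ) ≤ x ^ 2 + y ^ 2 := by
    by_contra h
    have h1 : x ^ 2 + y ^ 2 = 0 := by nlinarith [sq_nonneg x, sq_nonneg y]
    have hx : x = 0 := by nlinarith [sq_nonneg x, sq_nonneg y, pow_eq_zero_iff (M₀ := ℤ) (a := x) two_ne_zero]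
    have hy : y = 0 := by nlinarith [sq_nonneg x, sq_nonneg y]
    exact hk (by simp [hx, hy])
  exact_mod_cast this

lemma finite_pre (c : ℝ) :
    {k : ℤ × ℤ | (k.1 : ℝ) ^ 2 + (k.2 : ℝ) ^ 2 ≤ c}.Finite := by
  apply ((Set.finite_Icc (-⌈c⌉) ⌈c⌉).prod (Set.finite_Icc (-⌈c⌉) ⌈c⌉)).subset
  rintro ⟨x, y⟩ h
  simp only [mem_ofPred_eq] at h
  have h2 : x ^ 2 + y ^ 2 ≤ ⌈c⌉ := by
    have := h.trans (Int.le_ceil c)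
    exact_mod_cast this
  have hx : |x| ≤ x ^ 2 := by
    rw [← sq_abs]; rcases (abs_nonneg x).eq_or_lt with h | h <;> nlinarith
  have hy : |y| ≤ y ^ 2 := by
    rw [← sq_abs]; rcases (abs_nonneg y).eq_or_lt with h | h <;> nlinarith
  simp only [mem_prod, Set.mem_Icc]
  rw [← abs_le, ← abs_le]
  constructor <;> nlinarith [sq_nonneg x, sq_nonneg y]

lemma finite_D (R : ℝ) : {k | nu k ≤ R}.Finite := by
  apply Set.Finite.of_finite_image (f := Subtype.val) _ Subtype.val_injective.injOn
  apply (finite_pre (R ^ 2)).subset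
  rintro _ ⟨k, hk, rfl⟩
  simp only [mem_ofPred_eq] at hk ⊢
  have h1 := one_le_nu k
  have : nu k ^ 2 ≤ R ^ 2 := by gcongr
  rwa [nu, Real.sq_sqrt (by positivity)] at this

noncomputable def A (R : ℝ) : ℕ := Set.ncard {k | nu k ≤ R}

lemma ncard_pre {R : ℝ} (hR : 0 ≤ R) :
    Set.ncard {k : ℤ × ℤ | (k.1 : ℝ) ^ 2 + (k.2 : ℝ) ^ 2 ≤ R ^ 2} = A R + 1 := by
  have : {k : ℤ × ℤ | (k.1 : ℝ) ^ 2 + (k.2 : ℝ) ^ 2 ≤ R ^ 2} =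
      insert 0 (Subtype.val '' {k | nu k ≤ R}) := by
    ext k
    by_cases hk : k = 0
    · subst hk; simp; positivity
    · simp [hk, nu, Real.sqrt_le_left hR]
  rw [this, Set.ncard_insert_of_notMem _ ((finite_D R).image _),
    Set.ncard_image_of_injective _ Subtype.val_injective]
  · rfl
  · rintro ⟨k, -, h⟩
    exact k.2 h

lemma exists_density : ∃ c : ℝ, 0 < c ∧ Tendsto (fun R : ℝ => (A R : ℝ) / R ^ 2) atTop (𝓝 c) := by
  let L : Submodule ℤ ℂ := Submodule.span ℤ (Set.range Complex.basisOneI)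
  have hball : {x : ℂ | x ∈ (univ : Set ℂ) ∧ ‖x‖ ^ 2 ≤ 1} = Metric.closedBall 0 1 := by
    ext x; simp [sq_le_one_iff₀]
  have key := ZLattice.covolume.tendsto_card_le_div' L (X := univ) (F := fun x => ‖x‖ ^ 2)
    (by simp) (by intro x r hr; simp [mul_pow]) (by rw [hball]; exact Metric.isBounded_closedBall)
    (by rw [hball]; exact Metric.isClosed_closedBall.measurableSet)
    (by rw [hball]; exact (convex_closedBall (0:ℂ) 1).addHaar_frontier volume)
  rw [hball] at key
  refine ⟨volume.real (Metric.closedBall (0:ℂ) 1) / ZLattice.covolume L, ?_, ?_⟩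
  · apply div_pos _ (ZLattice.covolume_pos L volume)
    rw [measureReal_def]
    apply ENNReal.toReal_pos
    · exact (Metric.measure_closedBall_pos volume _ one_pos).ne'
    · exact measure_closedBall_lt_top.ne
  · have hsq : Tendsto (fun R : ℝ => R ^ 2) atTop atTop := tendsto_pow_atTop two_ne_zero
    have k2 := (key.comp hsq).sub (tendsto_inv_atTop_zero.comp hsq)
    rw [sub_zero] at k2
    refine k2.congr' ?_
    filter_upwards [eventually_gt_atTop 0] with R hR
    have himg : ({x : ℂ | x ∈ (univ : Set ℂ) ∧ ‖x‖ ^ 2 ≤ R ^ 2} ∩ L : Set ℂ) =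
        (fun k : ℤ × ℤ => ((k.1 : ℂ) + k.2 * Complex.I)) ''
          {k : ℤ × ℤ | (k.1 : ℝ) ^ 2 + (k.2 : ℝ) ^ 2 ≤ R ^ 2} := by
      ext z
      simp only [mem_inter_iff, mem_ofPred_eq, mem_univ, true_and, SetLike.mem_coe, mem_image]
      rw [Module.Basis.mem_span_iff_repr_mem]
      constructor
      · rintro ⟨h1, h2⟩
        obtain ⟨m, hm⟩ := h2 0
        obtain ⟨n, hn⟩ := h2 1
        simp at hm hn
        refine ⟨(m, n), ?_, ?_⟩
        · rw [Complex.sq_norm, Complex.normSq_apply, ← hm, ← hn] at h1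
          simp only; nlinarith
        · apply Complex.ext <;> simp [hm, hn]
      · rintro ⟨⟨m, n⟩, h1, rfl⟩
        constructor
        · rw [Complex.sq_norm, Complex.normSq_apply]
          simp at h1 ⊢; nlinarith
        · intro i
          fin_cases i <;> simp
    have hinj : Function.Injective (fun k : ℤ × ℤ => ((k.1 : ℂ) + k.2 * Complex.I)) := by
      rintro ⟨m, n⟩ ⟨m', n'⟩ h
      have h1 := congrArg Complex.re h
      have h2 := congrArg Complex.im h
      simp at h1 h2
      simp [h1, h2]
    simp only [Function.comp]
    rw [himg, Nat.card_coe_set_eq, Set.ncard_image_of_injective _ hinj, ncard_pre hR.le]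
    push_cast
    field_simp
    ring

lemma A_mono : Monotone A := fun _ S h =>
  Set.ncard_le_ncard (fun _ hk => le_trans hk h) (finite_D S)

lemma A_zero {R : ℝ} (h : R < 1) : A R = 0 := by
  unfold A
  have : {k | nu k ≤ R} = ∅ := by
    ext k
    simpa using h.trans_le (one_le_nu k)
  rw [this, Set.ncard_empty]

lemma A_bound : ∃ C : ℝ, ∀ R : ℝ, 0 < R → (A R : ℝ) ≤ C * R ^ 2 := by
  obtain ⟨c, hc, h⟩ := exists_density
  have h1 := (h.eventually (ge_mem_nhds (show c < c + 1 by linarith)))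
  obtain ⟨R0, hR0⟩ := eventually_atTop.1 h1
  refine ⟨c + 1 + A R0, fun R hR => ?_⟩
  have hA : (0:ℝ) ≤ A R0 := by positivity
  by_cases h2 : R < 1
  · rw [A_zero h2]; push_cast; positivity
  push Not at h2
  rcases le_total R0 R with h3 | h3
  · have := hR0 R h3
    rw [div_le_iff₀ (by positivity)] at this
    nlinarith [sq_nonneg R]
  · have : (A R : ℝ) ≤ A R0 := by exact_mod_cast A_mono h3
    have : 1 ≤ R ^ 2 := by nlinarith
    nlinarith

/-- Power sums over lattice points in the disc. -/
noncomputable def T (b R : ℝ) : ℝ := ∑ k ∈ (finite_D R).toFinset, nu k ^ b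

lemma rpow_eq (b : ℝ) {r : ℝ} (h0 : 0 < r) (h1 : r ≤ 1) :
    IntegrableOn (fun t : ℝ => if r ≤ t then b * t ^ (b - 1) else 0) (Ioc 0 1) ∧
    r ^ b = 1 - ∫ t in Ioc (0:ℝ) 1, (if r ≤ t then b * t ^ (b - 1) else 0) := by
  have hcont : ContinuousOn (fun t : ℝ => b * t ^ (b - 1)) (Icc r 1) := by
    intro t ht
    have : t ≠ 0 := (h0.trans_le ht.1).ne'
    exact (continuousAt_const.mul (Real.continuousAt_rpow_const t _ (Or.inl this))).continuousWithinAt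
  have hfun : (fun t : ℝ => if r ≤ t then b * t ^ (b - 1) else 0) =
      (Ici r).indicator (fun t => b * t ^ (b - 1)) := by
    ext t; simp [indicator]
  have hint : Ioc (0:ℝ) 1 ∩ Ici r = Icc r 1 := by
    ext t; simp only [mem_inter_iff, Set.mem_Ioc, Set.mem_Ici, Set.mem_Icc]
    constructor
    · rintro ⟨⟨_, h⟩, h'⟩; exact ⟨h', h⟩
    · rintro ⟨h, h'⟩; exact ⟨⟨h0.trans_le h, h'⟩, h⟩
  constructor
  · rw [hfun, integrableOn_indicator_iff measurableSet_Ici, inter_comm, hint]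
    exact hcont.integrableOn_Icc
  · rw [hfun, setIntegral_indicator measurableSet_Ici, hint, integral_Icc_eq_integral_Ioc,
      ← intervalIntegral.integral_of_le h1,
      intervalIntegral.integral_eq_sub_of_hasDerivAt (f := fun t => t ^ b)]
    · simp
    · intro t ht
      rw [uIcc_of_le h1] at ht
      exact Real.hasDerivAt_rpow_const (Or.inl (h0.trans_le ht.1).ne')
    · apply ContinuousOn.intervalIntegrable
      rwa [uIcc_of_le h1]

lemma T_eq (b : ℝ) {R : ℝ} (hR : 0 < R) :
    R ^ (-b) * T b R = A R - ∫ t in Ioc (0:ℝ) 1, b * t ^ (b - 1) * A (t * R) := by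
  have hmem : ∀ k ∈ (finite_D R).toFinset, 0 < nu k / R ∧ nu k / R ≤ 1 := by
    intro k hk
    have h1 := one_le_nu k
    have : nu k ≤ R := by simpa using hk
    exact ⟨by positivity, by rwa [div_le_one hR]⟩
  have e1 : R ^ (-b) * T b R = ∑ k ∈ (finite_D R).toFinset, (nu k / R) ^ b := by
    rw [T, Finset.mul_sum]
    apply Finset.sum_congr rfl
    intro k hk
    have h1 := one_le_nu k
    rw [Real.div_rpow (by linarith) hR.le, Real.rpow_neg hR.le]
    field_simp
  rw [e1, Finset.sum_congr rfl (fun k hk => (rpow_eq b (hmem k hk).1 (hmem k hk).2).2),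
    Finset.sum_sub_distrib, ← integral_finsetSum _
      (fun k hk => (rpow_eq b (hmem k hk).1 (hmem k hk).2).1)]
  congr 1
  · simp [A, Set.ncard_eq_toFinset_card _ (finite_D R)]
  · apply setIntegral_congr_fun measurableSet_Ioc
    intro t ht
    simp only
    rw [← Finset.sum_filter, Finset.sum_const, nsmul_eq_mul, mul_comm]
    congr 2
    rw [A, Set.ncard_eq_toFinset_card _ (finite_D (t * R))]
    congr 1
    ext k
    simp only [Finset.mem_filter, Set.Finite.mem_toFinset, mem_ofPred_eq, div_le_iff₀ hR]
    constructor
    · exact fun h => h.2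
    · exact fun h => ⟨h.trans (by nlinarith [ht.2]), h⟩

lemma T_tendsto {c : ℝ} (h : Tendsto (fun R : ℝ => (A R : ℝ) / R ^ 2) atTop (𝓝 c))
    {b : ℝ} (hb : -2 < b) :
    Tendsto (fun N : ℕ => (N : ℝ) ^ (-b) * T b N / (N : ℝ) ^ 2) atTop (𝓝 (2 * c / (b + 2))) := by
  obtain ⟨C, hC⟩ := A_bound
  have hlim : Tendsto (fun N : ℕ => ∫ t in Ioc (0:ℝ) 1, b * t ^ (b - 1) * A (t * N) / (N : ℝ) ^ 2)
      atTop (𝓝 (∫ t in Ioc (0:ℝ) 1, b * c * t ^ (b + 1))) := by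
    apply tendsto_integral_of_dominated_convergence (fun t => |b| * C * t ^ (b + 1))
    · intro N
      apply Measurable.aestronglyMeasurable
      have : Measurable (fun t : ℝ => (A (t * N) : ℝ)) := by
        apply Monotone.measurable
        intro s t hst
        have : s * N ≤ t * N := by gcongr
        simpa using A_mono this
      fun_prop
    · apply Integrable.const_mul
      have := (intervalIntegral.intervalIntegrable_rpow' (a := 0) (b := 1)
        (show -1 < b + 1 by linarith))
      rwa [intervalIntegrable_iff_integrableOn_Ioc_of_le zero_le_one] at this
    · intro N
      filter_upwards [ae_restrict_mem measurableSet_Ioc] with t ht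
      have ht0 := ht.1
      rcases Nat.eq_zero_or_pos N with rfl | hN
      · have hC0 : 0 ≤ C := by
          have := hC 1 one_pos
          have h2 : (0:ℝ) ≤ A 1 := by positivity
          linarith
        simp; positivity
      · have hN' : (0:ℝ) < N := by exact_mod_cast hN
        have := hC (t * N) (by positivity)
        rw [norm_div, norm_mul, norm_mul]
        simp only [Real.norm_eq_abs, abs_pow, Nat.abs_cast]
        rw [abs_of_pos (Real.rpow_pos_of_pos ht0 _), div_le_iff₀ (by positivity),
          show b + 1 = (b - 1) + 2 by ring, Real.rpow_add ht0, Real.rpow_two]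
        calc _ ≤ |b| * t ^ (b - 1) * (C * (t * N) ^ 2) := by gcongr
          _ = _ := by ring
    · filter_upwards [ae_restrict_mem measurableSet_Ioc] with t ht
      have ht0 := ht.1
      have h1 : Tendsto (fun N : ℕ => t * (N : ℝ)) atTop atTop :=
        tendsto_natCast_atTop_atTop.const_mul_atTop ht0
      have h2 := (h.comp h1).const_mul (b * t ^ (b + 1))
      rw [show b * c * t ^ (b + 1) = b * t ^ (b + 1) * c by ring]
      refine h2.congr fun N => ?_
      simp only [Function.comp]
      rw [show b + 1 = (b - 1) + 2 by ring, Real.rpow_add ht0, Real.rpow_two, mul_pow]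
      field_simp
  have hval : ∫ t in Ioc (0:ℝ) 1, b * c * t ^ (b + 1) = b * c / (b + 2) := by
    rw [← intervalIntegral.integral_of_le zero_le_one, intervalIntegral.integral_const_mul,
      integral_rpow (Or.inl (by linarith)), Real.one_rpow, Real.zero_rpow (by linarith)]
    rw [show b + 1 + 1 = b + 2 by ring]
    ring
  rw [hval] at hlim
  have := (h.comp tendsto_natCast_atTop_atTop).sub hlim
  have hb2 : b + 2 ≠ 0 := by linarith
  rw [show c - b * c / (b + 2) = 2 * c / (b + 2) by field_simp; ring] at this
  refine this.congr' ?_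
  filter_upwards [eventually_gt_atTop 0] with N hN
  have hN' : (0:ℝ) < N := by exact_mod_cast hN
  rw [T_eq b hN', sub_div]
  simp only [Function.comp, integral_div]

lemma tsum_eq_T (b : ℝ) (R : ℝ) : (∑' k, if nu k ≤ R then nu k ^ b else 0) = T b R := by
  rw [tsum_eq_sum (s := (finite_D R).toFinset), T]
  · apply Finset.sum_congr rfl
    intro k hk
    rw [if_pos (by simpa using hk)]
  · intro k hk
    rw [if_neg (by simpa using hk)]

end Stmt4

/-- Fix `a ∈ (0,1)`, `τ > 0`, `p ≥ 1`. With `ε_N` and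
`θ^{(N)}` as in Example 2.6 of the paper,
`lim_{N→∞} N^{−pτ} ∑_{k∈ℤ²∖{0}} (θ^{(N)}_k)² |k|^{pτ} = (2−2a)/(2−2a+pτ)`. -/
theorem stmt_4 (a : ℝ) (ha0 : 0 < a) (ha1 : a < 1)
    (τ p : ℝ) (hτ : 0 < τ) (hp : 1 ≤ p)
    (ε : ℕ → ℝ)
    (hε : ∀ N : ℕ,
      ε N = (∑' k : {k : ℤ × ℤ // k ≠ 0},
        (if k.1.1 ^ 2 + k.1.2 ^ 2 ≤ (N : ℤ) ^ 2
          then Real.sqrt ((k.1.1 : ℝ) ^ 2 + (k.1.2 : ℝ) ^ 2) ^ (-(2 * a)) else 0))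
            ^ (-(1 / 2) : ℝ))
    (θ : ℕ → {k : ℤ × ℤ // k ≠ 0} → ℝ)
    (hθ : ∀ (N : ℕ) (k : {k : ℤ × ℤ // k ≠ 0}),
      θ N k = if (1 : ℝ) ≤ Real.sqrt ((k.1.1 : ℝ) ^ 2 + (k.1.2 : ℝ) ^ 2) ∧
          Real.sqrt ((k.1.1 : ℝ) ^ 2 + (k.1.2 : ℝ) ^ 2) ≤ (N : ℝ)
        then ε N * Real.sqrt ((k.1.1 : ℝ) ^ 2 + (k.1.2 : ℝ) ^ 2) ^ (-a) else 0) :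
    Filter.Tendsto
      (fun N : ℕ => (N : ℝ) ^ (-(p * τ)) *
        ∑' k : {k : ℤ × ℤ // k ≠ 0},
          (θ N k) ^ 2 * Real.sqrt ((k.1.1 : ℝ) ^ 2 + (k.1.2 : ℝ) ^ 2) ^ (p * τ))
      Filter.atTop (nhds ((2 - 2 * a) / (2 - 2 * a + p * τ))) := by
  have hcond : ∀ (N : ℕ) (k : {k : ℤ × ℤ // k ≠ 0}),
      (k.1.1 ^ 2 + k.1.2 ^ 2 ≤ (N : ℤ) ^ 2) ↔ Stmt4.nu k ≤ N := by
    intro N k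
    rw [Stmt4.nu, Real.sqrt_le_left (by positivity)]
    exact_mod_cast Iff.rfl
  have hnu : ∀ k : {k : ℤ × ℤ // k ≠ 0},
      Real.sqrt ((k.1.1 : ℝ) ^ 2 + (k.1.2 : ℝ) ^ 2) = Stmt4.nu k := fun _ => rfl
  simp only [hcond, hnu, Stmt4.tsum_eq_T] at hε hθ ⊢
  have hTnn : ∀ (b : ℝ) (N : ℕ), 0 ≤ Stmt4.T b N := fun b N =>
    Finset.sum_nonneg fun k _ => Real.rpow_nonneg (by linarith [Stmt4.one_le_nu k]) _
  have hε2 : ∀ N, ε N ^ 2 = (Stmt4.T (-(2 * a)) N)⁻¹ := by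
    intro N
    rw [hε, ← Real.rpow_natCast, ← Real.rpow_mul (hTnn _ _)]
    norm_num
    rw [Real.rpow_neg_one]
  have hterm : ∀ (N : ℕ) (k : {k : ℤ × ℤ // k ≠ 0}), θ N k ^ 2 * Stmt4.nu k ^ (p * τ) =
      (Stmt4.T (-(2 * a)) N)⁻¹ *
        (if Stmt4.nu k ≤ N then Stmt4.nu k ^ (p * τ - 2 * a) else 0) := by
    intro N k
    have h1 := Stmt4.one_le_nu k
    have h0 : 0 < Stmt4.nu k := by linarith
    rw [hθ]
    by_cases h : Stmt4.nu k ≤ N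
    · rw [if_pos ⟨h1, h⟩, if_pos h, mul_pow, hε2, ← Real.rpow_natCast (Stmt4.nu k ^ (-a)),
        ← Real.rpow_mul h0.le, mul_assoc, ← Real.rpow_add h0]
      congr 2
      push_cast; ring
    · rw [if_neg (fun h' => h h'.2), if_neg h]; simp
  simp only [hterm, tsum_mul_left, Stmt4.tsum_eq_T]
  obtain ⟨c, hc, hA⟩ := Stmt4.exists_density
  have hpt : 0 < p * τ := by positivity
  have t1 := Stmt4.T_tendsto hA (b := -(2 * a)) (by linarith)
  have t2 := Stmt4.T_tendsto hA (b := p * τ - 2 * a) (by linarith)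
  have hd1 : -(2 * a) + 2 ≠ 0 := by linarith
  have hd2 : p * τ - 2 * a + 2 ≠ 0 := by linarith
  have hd3 : 2 - 2 * a + p * τ ≠ 0 := by linarith
  have t3 := t2.div t1 (by positivity)
  have hval : 2 * c / (p * τ - 2 * a + 2) / (2 * c / (-(2 * a) + 2)) =
      (2 - 2 * a) / (2 - 2 * a + p * τ) := by
    rw [show p * τ - 2 * a + 2 = 2 - 2 * a + p * τ by ring,
      show -(2 * a) + 2 = 2 - 2 * a by ring]
    have : 2 - 2 * a ≠ 0 := by linarith
    rw [div_div_div_eq, mul_comm (2 - 2 * a + p * τ), mul_div_mul_left _ _ (by positivity)]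
  rw [hval] at t3
  refine t3.congr' ?_
  filter_upwards [Filter.eventually_gt_atTop 0] with N hN
  have hN' : (0:ℝ) < N := by exact_mod_cast hN
  simp only [Pi.div_apply]
  rw [show -(p * τ - 2 * a) = -(p * τ) + -(-(2 * a)) by ring, Real.rpow_add hN']
  have hq : (N : ℝ) ^ (-(-(2 * a))) ≠ 0 := (Real.rpow_pos_of_pos hN' _).ne'
  generalize (N : ℝ) ^ (-(-(2 * a))) = q at *
  rw [div_div_div_cancel_right₀ (by positivity), mul_right_comm, mul_comm _ q,
    mul_div_mul_left _ _ hq]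
  ring
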